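/- The set of monomials {e^i f^j h^k : i, j, k ≥ 0} is a k-vector-space basis of the algebra Û(g) = k⟨e,f,h⟩/⟨ef + fe − h, he − eh, hf − fh⟩. (Equivalently, Û(g) is the Ore extension k[h,e][f; σ, δ] with σ(e) = −e, σ(h) = h, δ(e) = h, δ(h) = 0, and in particular the generators e, f, h span a 3-dimensional subspace of Û(g).) -/

import Mathlib

/-- Relations of `Û(g) = k⟨e,f,h⟩/⟨ef+fe−h, he−eh, hf−fh⟩`: generators `0=e, 1=f, 2=h`. -/
inductive UhatRel (k : Type) [Field k] :
    FreeAlgebra k (Fin 3) → FreeAlgebra k (Fin 3) → Prop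
  | ef : UhatRel k
      (FreeAlgebra.ι k 0 * FreeAlgebra.ι k 1 + FreeAlgebra.ι k 1 * FreeAlgebra.ι k 0)
      (FreeAlgebra.ι k 2)
  | he : UhatRel k (FreeAlgebra.ι k 2 * FreeAlgebra.ι k 0) (FreeAlgebra.ι k 0 * FreeAlgebra.ι k 2)
  | hf : UhatRel k (FreeAlgebra.ι k 2 * FreeAlgebra.ι k 1) (FreeAlgebra.ι k 1 * FreeAlgebra.ι k 2)

/-- `Û(g) = k⟨e,f,h⟩/⟨ef+fe−h, he−eh, hf−fh⟩`. -/
abbrev Uhat (k : Type) [Field k] := RingQuot (UhatRel k)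

/-- The images of the generators `e, f, h` in `Û(g)`. -/
def genU (k : Type) [Field k] (i : Fin 3) : Uhat k :=
  RingQuot.mkAlgHom k (UhatRel k) (FreeAlgebra.ι k i)


section Helpers
variable (k : Type) [Field k]

/-- Left multiplication by `e` on the model space. -/
noncomputable def opE : Module.End k (ℕ × ℕ × ℕ →₀ k) :=
  Finsupp.linearCombination k fun p => Finsupp.single (p.1 + 1, p.2.1, p.2.2) 1

/-- Left multiplication by `f` on the model space. -/
noncomputable def opF : Module.End k (ℕ × ℕ × ℕ →₀ k) :=
  Finsupp.linearCombination k fun p =>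
    Finsupp.single (p.1, p.2.1 + 1, p.2.2) ((-1) ^ p.1) +
      if Odd p.1 then Finsupp.single (p.1 - 1, p.2.1, p.2.2 + 1) 1 else 0

/-- Left multiplication by `h` on the model space. -/
noncomputable def opH : Module.End k (ℕ × ℕ × ℕ →₀ k) :=
  Finsupp.linearCombination k fun p => Finsupp.single (p.1, p.2.1, p.2.2 + 1) 1

lemma opE_single (i j l : ℕ) (c : k) :
    opE k (Finsupp.single (i, j, l) c) = Finsupp.single (i + 1, j, l) c := by
  simp [opE, Finsupp.linearCombination_single]

lemma opH_single (i j l : ℕ) (c : k) :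
    opH k (Finsupp.single (i, j, l) c) = Finsupp.single (i, j, l + 1) c := by
  simp [opH, Finsupp.linearCombination_single]

lemma opF_single (i j l : ℕ) (c : k) :
    opF k (Finsupp.single (i, j, l) c) = Finsupp.single (i, j + 1, l) (c * (-1) ^ i) +
      if Odd i then Finsupp.single (i - 1, j, l + 1) c else 0 := by
  simp [opF, Finsupp.linearCombination_single]

lemma op_ef : opE k * opF k + opF k * opE k = opH k := by
  refine Finsupp.lhom_ext fun p c => ?_
  obtain ⟨i, j, l⟩ := p
  simp only [LinearMap.add_apply, Module.End.mul_apply, opF_single, opE_single, opH_single, map_add]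
  rcases Nat.even_or_odd i with hi | hi
  · have h1 : ¬ Odd i := Nat.not_odd_iff_even.mpr hi
    have h2 : Odd (i + 1) := hi.add_one
    simp [h1, h2, pow_succ, hi.neg_one_pow, ← add_assoc, ← Finsupp.single_add]
  · have h2 : ¬ Odd (i + 1) := Nat.not_odd_iff_even.mpr hi.add_one
    have h3 : i - 1 + 1 = i := Nat.sub_add_cancel hi.pos
    simp only [hi, h2, if_true, if_false, opE_single, h3, pow_succ, add_zero]
    rw [add_right_comm, ← Finsupp.single_add]
    simp

lemma op_he : opH k * opE k = opE k * opH k := by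
  refine Finsupp.lhom_ext fun p c => ?_
  obtain ⟨i, j, l⟩ := p
  simp only [Module.End.mul_apply, opE_single, opH_single]

lemma op_hf : opH k * opF k = opF k * opH k := by
  refine Finsupp.lhom_ext fun p c => ?_
  obtain ⟨i, j, l⟩ := p
  simp only [Module.End.mul_apply, opF_single, opH_single, map_add]
  split_ifs <;> simp [opH_single]

/-- The representation of the algebra on the model space. -/
noncomputable def repU : Uhat k →ₐ[k] Module.End k (ℕ × ℕ × ℕ →₀ k) :=
  RingQuot.liftAlgHom k ⟨FreeAlgebra.lift k ![opE k, opF k, opH k], by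
    intro x y hxy
    cases hxy
    · simpa using op_ef k
    · simpa using op_he k
    · simpa using op_hf k⟩

lemma repU_gen (i : Fin 3) : repU k (genU k i) = ![opE k, opF k, opH k] i := by
  simp [repU, genU]

lemma opE_pow (n i j l : ℕ) (c : k) :
    (opE k ^ n) (Finsupp.single (i, j, l) c) = Finsupp.single (i + n, j, l) c := by
  induction n with
  | zero => simp
  | succ n ih => rw [pow_succ', Module.End.mul_apply, ih, opE_single, add_assoc]

lemma opH_pow (n i j l : ℕ) (c : k) :
    (opH k ^ n) (Finsupp.single (i, j, l) c) = Finsupp.single (i, j, l + n) c := by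
  induction n with
  | zero => simp
  | succ n ih => rw [pow_succ', Module.End.mul_apply, ih, opH_single, add_assoc]

lemma opF_pow (n j l : ℕ) (c : k) :
    (opF k ^ n) (Finsupp.single (0, j, l) c) = Finsupp.single (0, j + n, l) c := by
  induction n with
  | zero => simp
  | succ n ih => rw [pow_succ', Module.End.mul_apply, ih, opF_single]; simp [add_assoc]

/-- The ordered monomials. -/
noncomputable def monU (p : ℕ × ℕ × ℕ) : Uhat k :=
  genU k 0 ^ p.1 * genU k 1 ^ p.2.1 * genU k 2 ^ p.2.2

lemma repU_mon (p : ℕ × ℕ × ℕ) :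
    repU k (monU k p) (Finsupp.single (0, 0, 0) 1) = Finsupp.single p 1 := by
  obtain ⟨i, j, l⟩ := p
  simp [monU, repU_gen, Module.End.mul_apply, opE_pow, opF_pow, opH_pow]

lemma monU_li : LinearIndependent k (monU k) := by
  refine LinearIndependent.of_comp
    ((LinearMap.applyₗ (Finsupp.single (0, 0, 0) (1 : k))).comp (repU k).toLinearMap) ?_
  have : (((LinearMap.applyₗ (Finsupp.single (0, 0, 0) (1 : k))).comp (repU k).toLinearMap) ∘
      monU k) = fun p : ℕ × ℕ × ℕ => Finsupp.single p (1 : k) := by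
    funext p
    exact repU_mon k p
  rw [this]
  exact Finsupp.linearIndependent_single_one k _

lemma gen_ef : genU k 0 * genU k 1 + genU k 1 * genU k 0 = genU k 2 := by
  simpa [genU] using RingQuot.mkAlgHom_rel k (UhatRel.ef (k := k))

lemma gen_he : Commute (genU k 2) (genU k 0) := by
  simpa [genU, commute_iff_eq] using RingQuot.mkAlgHom_rel k (UhatRel.he (k := k))

lemma gen_hf : Commute (genU k 2) (genU k 1) := by
  simpa [genU, commute_iff_eq] using RingQuot.mkAlgHom_rel k (UhatRel.hf (k := k))

lemma e_mon (i j l : ℕ) : genU k 0 * monU k (i, j, l) = monU k (i + 1, j, l) := by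
  simp only [monU, pow_succ', mul_assoc]

lemma h_mon (i j l : ℕ) : genU k 2 * monU k (i, j, l) = monU k (i, j, l + 1) := by
  simp only [monU, pow_succ', ← mul_assoc]
  rw [((gen_he k).pow_right i).eq, mul_assoc (genU k 0 ^ i), ((gen_hf k).pow_right j).eq]
  simp only [mul_assoc]

lemma f_mon_mem (i j l : ℕ) :
    genU k 1 * monU k (i, j, l) ∈ Submodule.span k (Set.range (monU k)) ∧
    genU k 0 * (genU k 1 * monU k (i, j, l)) ∈ Submodule.span k (Set.range (monU k)) := by
  have hm (p) : monU k p ∈ Submodule.span k (Set.range (monU k)) :=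
    Submodule.subset_span ⟨p, rfl⟩
  have fe (x : Uhat k) : genU k 1 * (genU k 0 * x) =
      genU k 2 * x - genU k 0 * (genU k 1 * x) := by
    rw [← gen_ef]; noncomm_ring
  have eclosed : ∀ x ∈ Submodule.span k (Set.range (monU k)),
      genU k 0 * x ∈ Submodule.span k (Set.range (monU k)) := by
    intro x hx
    induction hx using Submodule.span_induction with
    | mem x hx => obtain ⟨⟨i, j, l⟩, rfl⟩ := hx; rw [e_mon]; exact hm _
    | zero => simp
    | add x y _ _ hx hy => rw [mul_add]; exact add_mem hx hy
    | smul a x _ hx => rw [mul_smul_comm]; exact Submodule.smul_mem _ _ hx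
  have key : genU k 1 * monU k (i, j, l) ∈ Submodule.span k (Set.range (monU k)) := by
    induction i with
    | zero =>
      have : genU k 1 * monU k (0, j, l) = monU k (0, j + 1, l) := by
        simp [monU, pow_succ', mul_assoc]
      rw [this]; exact hm _
    | succ i ih =>
      rw [← e_mon, fe, h_mon]
      exact sub_mem (hm _) (eclosed _ ih)
  exact ⟨key, eclosed _ key⟩

lemma gen_mul_mem (g : Fin 3) (x : Uhat k) (hx : x ∈ Submodule.span k (Set.range (monU k))) :
    genU k g * x ∈ Submodule.span k (Set.range (monU k)) := by
  induction hx using Submodule.span_induction with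
  | mem x hx =>
    obtain ⟨⟨i, j, l⟩, rfl⟩ := hx
    fin_cases g
    · exact (e_mon k i j l).symm ▸ Submodule.subset_span ⟨_, rfl⟩
    · exact (f_mon_mem k i j l).1
    · exact (h_mon k i j l).symm ▸ Submodule.subset_span ⟨_, rfl⟩
  | zero => simp
  | add x y _ _ hx hy => rw [mul_add]; exact add_mem hx hy
  | smul a x _ hx => rw [mul_smul_comm]; exact Submodule.smul_mem _ _ hx

lemma monU_span : Submodule.span k (Set.range (monU k)) = ⊤ := by
  rw [eq_top_iff]
  rintro y -
  obtain ⟨a, rfl⟩ := RingQuot.mkAlgHom_surjective k (UhatRel k) y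
  have key : ∀ x ∈ Submodule.span k (Set.range (monU k)),
      RingQuot.mkAlgHom k (UhatRel k) a * x ∈ Submodule.span k (Set.range (monU k)) := by
    induction a using FreeAlgebra.induction with
    | grade0 r =>
      intro x hx
      rw [AlgHom.commutes, ← Algebra.smul_def]
      exact Submodule.smul_mem _ _ hx
    | grade1 g => exact gen_mul_mem k g
    | mul a b ha hb =>
      intro x hx
      rw [map_mul, mul_assoc]
      exact ha _ (hb _ hx)
    | add a b ha hb =>
      intro x hx
      rw [map_add, add_mul]
      exact add_mem (ha _ hx) (hb _ hx)
  have h1 : (1 : Uhat k) ∈ Submodule.span k (Set.range (monU k)) :=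
    Submodule.subset_span ⟨(0, 0, 0), by simp [monU]⟩
  simpa using key 1 h1

lemma gen_li : LinearIndependent k (genU k) := by
  have h := (monU_li k).comp ![(1, 0, 0), (0, 1, 0), (0, 0, 1)] (by decide)
  convert h using 1
  funext i
  fin_cases i <;> simp [monU]

end Helpers

/-- PBW-type basis for `Û(g) = k⟨e,f,h⟩/⟨ef+fe−h, he−eh, hf−fh⟩`:
the monomials `e^i f^j h^k` form a `k`-basis; in particular `e, f, h` span a
3-dimensional subspace of `Û(g)`. -/
theorem stmt8 (k : Type) [Field k] [IsAlgClosed k] (hchar : (2 : k) ≠ 0) :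
    LinearIndependent k
      (fun p : ℕ × ℕ × ℕ => genU k 0 ^ p.1 * genU k 1 ^ p.2.1 * genU k 2 ^ p.2.2) ∧
    Submodule.span k
      (Set.range fun p : ℕ × ℕ × ℕ => genU k 0 ^ p.1 * genU k 1 ^ p.2.1 * genU k 2 ^ p.2.2) =
      ⊤ ∧
    Module.finrank k ↥(Submodule.span k {genU k 0, genU k 1, genU k 2}) = 3 := by
  refine ⟨monU_li k, monU_span k, ?_⟩
  have h := finrank_span_eq_card (gen_li k)
  have hr : Set.range (genU k) = {genU k 0, genU k 1, genU k 2} := by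
    ext x
    simp [Fin.exists_fin_succ, eq_comm]
  rw [hr] at h
  simpa using h
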